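/- For any positive integers N, d, any rational a = p/q ∈ [0,1] (with q > 0, gcd(p,q) = 1), and any nonnegative vectors u_1, ..., u_N in ℝ^d, there exists a set of indices I ⊆ {1,...,N} with |I| ≤ (d-1) + ⌈(pN - d + 1)/q⌉ such that ∑_{i ∈ I} u_i ≥ (p/q) ∑_{i=1}^N u_i coordinatewise. -/

import Mathlib

open Finset

/-- The polytope of `N × q` matrices with entries in `[0, 1]` whose rows sum to `p` and each of
whose columns collects the share `p / q` of the total of the vectors `u i`. -/
def sharePolytope {N d : ℕ} (p q : ℕ) (u : Fin N → Fin d → ℝ) : Set (Fin N → Fin q → ℝ) :=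
  {x | x ∈ Set.Icc 0 1 ∧ (∀ i, ∑ j, x i j = p) ∧
    ∀ j k, ∑ i, x i j * u i k = (p / q : ℝ) * ∑ i, u i k}

lemma isCompact_sharePolytope {N d : ℕ} (p q : ℕ) (u : Fin N → Fin d → ℝ) :
    IsCompact (sharePolytope p q u) := by
  refine isCompact_Icc.inter_right (IsClosed.and ?_ ?_)
  · simp only [Set.ofPred_forall]
    exact isClosed_iInter fun i => isClosed_eq (by fun_prop) (by fun_prop)
  · simp only [Set.ofPred_forall]
    exact isClosed_iInter fun j => isClosed_iInter fun k =>
      isClosed_eq (by fun_prop) (by fun_prop)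

lemma sharePolytope_nonempty {N d p q : ℕ} (hq : 0 < q) (hpq : p ≤ q) (u : Fin N → Fin d → ℝ) :
    (sharePolytope p q u).Nonempty := by
  have hq' : (0 : ℝ) < q := by exact_mod_cast hq
  have hpq' : (p : ℝ) ≤ q := by exact_mod_cast hpq
  refine ⟨fun _ _ => p / q, ⟨fun i j => ?_, fun i j => ?_⟩, fun i => ?_, fun j k => ?_⟩
  · simp only [Pi.zero_apply]; positivity
  · simpa using div_le_one_of_le₀ hpq' hq'.le
  · simp; field_simp
  · rw [mul_sum]

/-- The positions of the entries of `x` lying strictly between `0` and `1`. -/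
noncomputable def fractional {N q : ℕ} (x : Fin N → Fin q → ℝ) : Finset (Fin N × Fin q) :=
  {e | 0 < x e.1 e.2 ∧ x e.1 e.2 < 1}

lemma mem_fractional {N q : ℕ} {x : Fin N → Fin q → ℝ} {e : Fin N × Fin q} :
    e ∈ fractional x ↔ 0 < x e.1 e.2 ∧ x e.1 e.2 < 1 := by
  simp [fractional]

/-- A direction supported on the fractional entries which preserves all the equality constraints
vanishes at an extreme point. -/
lemma eq_zero_of_mem_extremePoints {N d p q : ℕ} {u : Fin N → Fin d → ℝ}
    {x y : Fin N → Fin q → ℝ} (hx : x ∈ (sharePolytope p q u).extremePoints ℝ)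
    (hsupp : ∀ i j, (i, j) ∉ fractional x → y i j = 0)
    (hrow : ∀ i, ∑ j, y i j = 0) (hcol : ∀ j k, ∑ i, y i j * u i k = 0) : y = 0 := by
  obtain ⟨⟨⟨hx0, hx1⟩, hxrow, hxcol⟩, hext⟩ := hx
  have hev : ∀ᶠ t : ℝ in nhdsWithin 0 (Set.Ioi 0), ∀ i j, (i, j) ∈ fractional x →
      (0 < x i j + t * y i j ∧ x i j + t * y i j < 1) ∧
        (0 < x i j - t * y i j ∧ x i j - t * y i j < 1) := by
    refine Filter.Eventually.filter_mono nhdsWithin_le_nhds ?_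
    simp only [Filter.eventually_all]
    intro i j h
    obtain ⟨h0, h1⟩ := mem_fractional.1 h
    have hp : Filter.Tendsto (fun t : ℝ => x i j + t * y i j) (nhds 0) (nhds (x i j)) := by
      have : Continuous fun t : ℝ => x i j + t * y i j := by fun_prop
      simpa using this.tendsto 0
    have hm : Filter.Tendsto (fun t : ℝ => x i j - t * y i j) (nhds 0) (nhds (x i j)) := by
      have : Continuous fun t : ℝ => x i j - t * y i j := by fun_prop
      simpa using this.tendsto 0
    exact ((hp.eventually_const_lt h0).and (hp.eventually_lt_const h1)).and
      ((hm.eventually_const_lt h0).and (hm.eventually_lt_const h1))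
  obtain ⟨t, ht, htpos⟩ := (hev.and self_mem_nhdsWithin).exists
  have hbound : ∀ i j, (0 ≤ x i j + t * y i j ∧ x i j + t * y i j ≤ 1) ∧
      (0 ≤ x i j - t * y i j ∧ x i j - t * y i j ≤ 1) := by
    intro i j
    by_cases h : (i, j) ∈ fractional x
    · obtain ⟨⟨a, b⟩, c, e⟩ := ht i j h
      exact ⟨⟨a.le, b.le⟩, c.le, e.le⟩
    · have h0 := hx0 i j
      have h1 := hx1 i j
      simp only [Pi.zero_apply, Pi.one_apply] at h0 h1
      simp [hsupp i j h, h0, h1]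
  have hplus : (fun i j => x i j + t * y i j) ∈ sharePolytope p q u := by
    refine ⟨⟨fun i j => (hbound i j).1.1, fun i j => (hbound i j).1.2⟩, fun i => ?_, fun j k => ?_⟩
    · rw [sum_add_distrib, ← mul_sum, hrow, hxrow]; simp
    · simp only [add_mul, mul_assoc]
      rw [sum_add_distrib, ← mul_sum, hcol, hxcol]; simp
  have hminus : (fun i j => x i j - t * y i j) ∈ sharePolytope p q u := by
    refine ⟨⟨fun i j => (hbound i j).2.1, fun i j => (hbound i j).2.2⟩, fun i => ?_, fun j k => ?_⟩
    · rw [sum_sub_distrib, ← mul_sum, hrow, hxrow]; simp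
    · simp only [sub_mul, mul_assoc]
      rw [sum_sub_distrib, ← mul_sum, hcol, hxcol]; simp
  have hmid : x ∈ openSegment ℝ (fun i j => x i j + t * y i j) (fun i j => x i j - t * y i j) := by
    refine ⟨1 / 2, 1 / 2, by norm_num, by norm_num, by norm_num, ?_⟩
    ext i j
    simp only [Pi.add_apply, Pi.smul_apply, smul_eq_mul]
    ring
  have heq := hext hplus hminus hmid
  ext i j
  have hij := congrFun (congrFun heq i) j
  have htne : t ≠ 0 := ne_of_gt htpos
  simpa [htne] using hij

lemma card_fractional_le {N d p m : ℕ} {u : Fin N → Fin d → ℝ} {x : Fin N → Fin (m + 1) → ℝ}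
    (hx : x ∈ (sharePolytope p (m + 1) u).extremePoints ℝ) :
    #(fractional x) ≤ #((fractional x).image Prod.fst) + m * d := by
  classical
  let R := (fractional x).image Prod.fst
  let v : Fin N × Fin (m + 1) → (R ⊕ Fin m × Fin d → ℝ) := fun e =>
    Sum.elim (fun r => if e.1 = r then 1 else 0)
      (fun c => if e.2 = c.1.castSucc then u e.1 c.2 else 0)
  have hv : LinearIndepOn ℝ v (fractional x : Set (Fin N × Fin (m + 1))) := by
    rw [linearIndepOn_finset_iff]
    intro f hf
    let y : Fin N → Fin (m + 1) → ℝ := fun i j => if (i, j) ∈ fractional x then f (i, j) else 0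
    have hsum (c : Fin N × Fin (m + 1) → ℝ) :
        ∑ e ∈ fractional x, f e * c e = ∑ i, ∑ j, y i j * c (i, j) := by
      rw [← Fintype.sum_prod_type' (f := fun i j => y i j * c (i, j))]
      simp [y, ite_mul, sum_ite_mem]
    have hrow : ∀ i, ∑ j, y i j = 0 := by
      intro i
      by_cases hi : i ∈ R
      · have h := congrFun hf (Sum.inl ⟨i, hi⟩)
        simp only [Finset.sum_apply, Pi.smul_apply, smul_eq_mul, Pi.zero_apply, v,
          Sum.elim_inl, hsum fun e => if e.1 = i then (1 : ℝ) else 0] at h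
        rw [sum_comm] at h
        simpa using h
      · refine sum_eq_zero fun j _ => if_neg fun h => hi ?_
        exact mem_image_of_mem Prod.fst h
    have hcol_castSucc (j : Fin m) (k : Fin d) : ∑ i, y i j.castSucc * u i k = 0 := by
      have h := congrFun hf (Sum.inr (j, k))
      simp only [Finset.sum_apply, Pi.smul_apply, smul_eq_mul, Pi.zero_apply, v,
        Sum.elim_inr, hsum fun e => if e.2 = j.castSucc then u e.1 k else 0] at h
      simpa using h
    have hcol : ∀ j k, ∑ i, y i j * u i k = 0 := by
      intro j k
      induction j using Fin.lastCases with
      | cast j => exact hcol_castSucc j k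
      | last =>
        have htotal : ∑ j, ∑ i, y i j * u i k = 0 := by
          rw [sum_comm]
          simp [← sum_mul, hrow]
        rw [Fin.sum_univ_castSucc] at htotal
        simpa [hcol_castSucc] using htotal
    have hy : y = 0 := eq_zero_of_mem_extremePoints hx (fun i j h => if_neg h) hrow hcol
    rintro ⟨i, j⟩ he
    have hij := congrFun (congrFun hy i) j
    simpa [y, he] using hij
  have hcard := LinearIndependent.fintype_card_le_finrank hv
  rwa [Module.finrank_fintype_fun_eq_card, Fintype.card_sum, Fintype.card_prod, Fintype.card_fin,
    Fintype.card_fin, Fintype.card_coe, ← Set.toFinset_card, Finset.toFinset_coe] at hcard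

/-- In a row of entries in `[0, 1]` with sum `p`, each fractional entry beyond the first one
accounts for at most one nonzero entry in excess of `p`. -/
lemma card_support_row_le {q p : ℕ} {x : Fin q → ℝ} (h0 : ∀ j, 0 ≤ x j) (h1 : ∀ j, x j ≤ 1)
    (hsum : ∑ j, x j = p) :
    #{j | x j ≠ 0} + (if ∃ j, 0 < x j ∧ x j < 1 then 1 else 0) ≤
      p + #{j | 0 < x j ∧ x j < 1} := by
  classical
  have hsplit : #{j | x j ≠ 0} ≤ #{j | x j = 1} + #{j | 0 < x j ∧ x j < 1} := by
    rw [← card_union_of_disjoint]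
    · refine card_le_card fun j hj => ?_
      simp only [mem_filter, mem_univ, true_and, mem_union] at hj ⊢
      rcases (h1 j).eq_or_lt with h | h
      · exact Or.inl h
      · exact Or.inr ⟨(h0 j).lt_of_ne' hj, h⟩
    · refine disjoint_filter.2 fun j _ hj h => ?_
      exact h.2.ne hj
  have hle : ∀ j ∈ univ, (if x j = 1 then (1 : ℝ) else 0) ≤ x j := by
    intro j _
    split_ifs with h
    · exact h.ge
    · exact h0 j
  have hones : ((#{j | x j = 1} : ℕ) : ℝ) = ∑ j, if x j = 1 then (1 : ℝ) else 0 := by simp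
  have : #{j | x j = 1} + (if ∃ j, 0 < x j ∧ x j < 1 then 1 else 0) ≤ p := by
    split_ifs with h
    · obtain ⟨j, hj0, hj1⟩ := h
      have hlt := sum_lt_sum hle ⟨j, mem_univ j, by simpa [hj1.ne] using hj0⟩
      rw [← hones, hsum] at hlt
      exact_mod_cast hlt
    · have hle' := sum_le_sum hle
      rw [← hones, hsum] at hle'
      exact_mod_cast hle'
  omega

lemma sum_card_support_le {N d p m : ℕ} {u : Fin N → Fin d → ℝ} {x : Fin N → Fin (m + 1) → ℝ}
    (hx : x ∈ (sharePolytope p (m + 1) u).extremePoints ℝ) :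
    ∑ j, #{i | x i j ≠ 0} ≤ p * N + m * d := by
  classical
  have hswap : ∑ j, #{i | x i j ≠ 0} = ∑ i, #{j | x i j ≠ 0} := by
    simp only [card_filter]
    exact sum_comm
  have hR : #((fractional x).image Prod.fst) =
      ∑ i, if ∃ j, 0 < x i j ∧ x i j < 1 then 1 else 0 := by
    rw [← card_filter]
    congr 1
    ext i
    simp [mem_fractional]
  have hF : #(fractional x) = ∑ i, #{j | 0 < x i j ∧ x i j < 1} := by
    simp only [fractional, card_filter]
    exact Fintype.sum_prod_type _
  have hrows := sum_le_sum fun i (_ : i ∈ univ) =>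
    card_support_row_le (fun j => hx.1.1.1 i j) (fun j => hx.1.1.2 i j) (hx.1.2.1 i)
  simp only [sum_add_distrib, sum_const, card_univ, Fintype.card_fin, smul_eq_mul] at hrows
  rw [← hswap, ← hR, ← hF] at hrows
  have hcard := card_fractional_le hx
  rw [mul_comm p N]
  omega

theorem stmt_0 (N d p q : ℕ) (hN : 0 < N) (hd : 0 < d) (hq : 0 < q)
    (hpq : p ≤ q) (hcop : Nat.Coprime p q)
    (u : Fin N → Fin d → ℝ) (hu : ∀ i j, 0 ≤ u i j) :
    ∃ I : Finset (Fin N),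
      (I.card : ℤ) ≤ (d - 1 : ℤ) + ⌈((p * N - d + 1 : ℚ) / q)⌉ ∧
      ∀ j, (p / q : ℝ) * ∑ i, u i j ≤ ∑ i ∈ I, u i j := by
  obtain ⟨m, rfl⟩ : ∃ m, q = m + 1 := ⟨q - 1, by omega⟩
  obtain ⟨x, hx⟩ := (isCompact_sharePolytope p (m + 1) u).extremePoints_nonempty
    (sharePolytope_nonempty hq hpq u)
  obtain ⟨j, hj⟩ : ∃ j, (m + 1) * #{i | x i j ≠ 0} ≤ p * N + m * d := by
    by_contra! h
    have hlt := sum_lt_sum_of_nonempty univ_nonempty fun j (_ : j ∈ univ) => h j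
    rw [← mul_sum, sum_const, card_univ, Fintype.card_fin, smul_eq_mul] at hlt
    exact absurd (sum_card_support_le hx) (not_le.2 (lt_of_mul_lt_mul_left' hlt))
  refine ⟨({i | x i j ≠ 0} : Finset (Fin N)), ?_, fun k => ?_⟩
  · have hj' : ((m : ℚ) + 1) * (#{i | x i j ≠ 0} : ℕ) ≤ p * N + m * d := by exact_mod_cast hj
    have hlt : ((#{i | x i j ≠ 0} : ℤ) - d) < ⌈((p * N - d + 1 : ℚ) / (m + 1 : ℕ))⌉ := by
      rw [Int.lt_ceil, lt_div_iff₀ (by positivity)]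
      push_cast
      linarith
    omega
  · rw [← hx.1.2.2 j k, sum_filter]
    refine sum_le_sum fun i _ => ?_
    split_ifs with h
    · exact mul_le_of_le_one_left (hu i k) (hx.1.1.2 i j)
    · simp [not_not.1 h]
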